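/- Let (X,d) be a geodesic metric space that is globally convex, and let C([0,1],X) denote the space of continuous maps [0,1] → X with the topology of uniform convergence and its Borel σ-algebra. Let Π be a probability measure on C([0,1],X) such that Π-almost every η is a geodesic, and suppose there exist x₀, x₁ ∈ X with ∫ d(x₀, η(0))² dΠ(η) < ∞ and ∫ d(x₁, η(1))² dΠ(η) < ∞. For t ∈ [0,1] let μ_t := (e_t)_*Π be the pushforward of Π under the evaluation map e_t(η) := η(t), and set var(μ) := inf_{x∈X} ∫ d(x,y)² dμ(y). Then for every t ∈ [0,1], √(var(μ_t)) ≤ (1−t) · √(var(μ₀)) + t · √(var(μ₁)); in particular t ↦ √(var(μ_t)) satisfies the chord inequality along the curve of measures (μ_t)_{t∈[0,1]}. -/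

import Mathlib

open Set MeasureTheory

/-- A (minimizing) geodesic parametrized by `[0,1]`. -/
def IsUnitGeodesic {X : Type*} [MetricSpace X] (γ : ℝ → X) : Prop :=
  ∀ s ∈ Icc (0 : ℝ) 1, ∀ t ∈ Icc (0 : ℝ) 1,
    dist (γ s) (γ t) = |t - s| * dist (γ 0) (γ 1)

/-- `(X,d)` is a geodesic space: any two points are joined by a geodesic. -/
def IsGeodesicSpace (X : Type*) [MetricSpace X] : Prop :=
  ∀ x y : X, ∃ γ : ℝ → X, IsUnitGeodesic γ ∧ γ 0 = x ∧ γ 1 = y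

/-- `(X,d)` is globally convex (Busemann nonpositive curvature). -/
def GloballyConvex (X : Type*) [MetricSpace X] : Prop :=
  ∀ γ₁ γ₂ : ℝ → X, IsUnitGeodesic γ₁ → IsUnitGeodesic γ₂ →
    ConvexOn ℝ (Icc (0 : ℝ) 1) (fun t => dist (γ₁ t) (γ₂ t))

/-- A continuous map `η : [0,1] → X` which is a (minimizing) geodesic. -/
def IsGeodesicMap {X : Type*} [MetricSpace X] (η : C(Icc (0 : ℝ) 1, X)) :
    Prop :=
  ∀ s t : Icc (0 : ℝ) 1,
    dist (η s) (η t) =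
      |(t : ℝ) - (s : ℝ)| * dist (η ⟨0, by norm_num⟩) (η ⟨1, by norm_num⟩)

/-- The variance `var(μ) = inf_{x∈X} ∫ d(x,y)² dμ(y)`. -/
noncomputable def var {X : Type*} [MetricSpace X] [MeasurableSpace X]
    (μ : Measure X) : ℝ :=
  ⨅ x : X, ∫ y, dist x y ^ 2 ∂μ

/-- Extending a geodesic map constantly outside `[0,1]` gives a geodesic. -/
lemma IsGeodesicMap.isUnitGeodesic {X : Type*} [MetricSpace X] {η : C(Icc (0 : ℝ) 1, X)}
    (h : IsGeodesicMap η) :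
    IsUnitGeodesic (fun t : ℝ => η (projIcc 0 1 zero_le_one t)) := by
  intro s hs t ht
  simp only [projIcc_of_mem zero_le_one hs, projIcc_of_mem zero_le_one ht, projIcc_left,
    projIcc_right]
  exact h ⟨s, hs⟩ ⟨t, ht⟩

/-- Busemann convexity compares a geodesic with a geodesic map. -/
lemma GloballyConvex.dist_le {X : Type*} [MetricSpace X] (hX : GloballyConvex X) {γ : ℝ → X}
    (hγ : IsUnitGeodesic γ) {η : C(Icc (0 : ℝ) 1, X)} (hη : IsGeodesicMap η)
    (t : Icc (0 : ℝ) 1) :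
    dist (γ t) (η t) ≤ (1 - (t : ℝ)) * dist (γ 0) (η ⟨0, by norm_num⟩) +
      t * dist (γ 1) (η ⟨1, by norm_num⟩) := by
  have h := (hX _ _ hγ hη.isUnitGeodesic).2 (left_mem_Icc.2 zero_le_one)
    (right_mem_Icc.2 zero_le_one) (sub_nonneg.2 t.2.2) t.2.1 (by ring)
  simpa [projIcc_left, projIcc_right] using h

/-- Minkowski's inequality in `L²` for a function dominated by a nonnegative combination. -/
lemma sqrt_integral_sq_le_of_le_add {Ω : Type*} [MeasurableSpace Ω] {P : Measure Ω}
    {f g h : Ω → ℝ} {a b : ℝ} (ha : 0 ≤ a) (hb : 0 ≤ b) (hf : ∀ ω, 0 ≤ f ω) (hg : ∀ ω, 0 ≤ g ω)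
    (hh : ∀ ω, 0 ≤ h ω) (hgL : MemLp g 2 P) (hhL : MemLp h 2 P)
    (hfgh : ∀ᵐ ω ∂P, f ω ≤ a * g ω + b * h ω) :
    √(∫ ω, f ω ^ 2 ∂P) ≤ a * √(∫ ω, g ω ^ 2 ∂P) + b * √(∫ ω, h ω ^ 2 ∂P) := by
  have hcs : ∫ ω, g ω * h ω ∂P ≤ √(∫ ω, g ω ^ 2 ∂P) * √(∫ ω, h ω ^ 2 ∂P) := by
    have := integral_mul_le_Lp_mul_Lq_of_nonneg (μ := P) Real.HolderConjugate.two_two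
      (ae_of_all _ hg) (ae_of_all _ hh) (by simpa using hgL) (by simpa using hhL)
    simpa [Real.sqrt_eq_rpow] using this
  have hgi := hgL.integrable_sq
  have hhi := hhL.integrable_sq
  have hghi : Integrable (fun ω => g ω * h ω) P := hgL.integrable_mul hhL
  have hsum : Integrable (fun ω => a ^ 2 * g ω ^ 2 + 2 * a * b * (g ω * h ω)) P :=
    (hgi.const_mul _).add (hghi.const_mul _)
  have hle : ∫ ω, f ω ^ 2 ∂P ≤
      ∫ ω, (a ^ 2 * g ω ^ 2 + 2 * a * b * (g ω * h ω) + b ^ 2 * h ω ^ 2) ∂P := by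
    refine integral_mono_of_nonneg (ae_of_all _ fun ω => sq_nonneg _)
      (hsum.add (hhi.const_mul _)) ?_
    filter_upwards [hfgh] with ω hω
    calc f ω ^ 2 ≤ (a * g ω + b * h ω) ^ 2 := pow_le_pow_left₀ (hf ω) hω 2
      _ = _ := by ring
  rw [integral_add hsum (hhi.const_mul _), integral_add (hgi.const_mul _) (hghi.const_mul _),
    integral_const_mul, integral_const_mul, integral_const_mul] at hle
  refine Real.sqrt_le_iff.2 ⟨by positivity, hle.trans ?_⟩
  have hG := Real.sq_sqrt (integral_nonneg (μ := P) fun ω => sq_nonneg (g ω))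
  have hH := Real.sq_sqrt (integral_nonneg (μ := P) fun ω => sq_nonneg (h ω))
  have hmul := mul_le_mul_of_nonneg_left hcs (by positivity : 0 ≤ 2 * a * b)
  calc _ ≤ a ^ 2 * √(∫ ω, g ω ^ 2 ∂P) ^ 2 +
        2 * a * b * (√(∫ ω, g ω ^ 2 ∂P) * √(∫ ω, h ω ^ 2 ∂P)) +
        b ^ 2 * √(∫ ω, h ω ^ 2 ∂P) ^ 2 := by
        rw [hG, hH]
        gcongr
    _ = _ := by ring

/-- If `d(x₀, ·)` is square integrable along `e`, then so is `d(x, ·)` for every `x`. -/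
lemma memLp_dist_of_integrable_sq {Ω X : Type*} [MeasurableSpace Ω] [MetricSpace X]
    [MeasurableSpace X] [BorelSpace X] {P : Measure Ω} [IsFiniteMeasure P] {e : Ω → X}
    (he : Measurable e) {x₀ : X} (h : Integrable (fun ω => dist x₀ (e ω) ^ 2) P) (x : X) :
    MemLp (fun ω => dist x (e ω)) 2 P := by
  have hm (y : X) : AEStronglyMeasurable (fun ω => dist y (e ω)) P :=
    ((continuous_const.dist continuous_id).measurable.comp he).aestronglyMeasurable
  refine ((memLp_const (dist x x₀)).add ((memLp_two_iff_integrable_sq (hm x₀)).2 h)).mono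
    (hm x) (ae_of_all _ fun ω => ?_)
  simp only [Pi.add_apply, Real.norm_eq_abs, abs_dist]
  exact (dist_triangle x x₀ (e ω)).trans (le_abs_self _)

lemma var_map {Ω X : Type*} [MeasurableSpace Ω] [MetricSpace X] [MeasurableSpace X]
    [BorelSpace X] (P : Measure Ω) {e : Ω → X} (he : Measurable e) :
    var (P.map e) = ⨅ x : X, ∫ ω, dist x (e ω) ^ 2 ∂P := by
  refine iInf_congr fun x => integral_map he.aemeasurable ?_
  exact ((continuous_const.dist continuous_id).pow 2).measurable.aestronglyMeasurable

/-- The square root of a nonnegative infimum is approximated by the square roots of the values. -/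
lemma exists_sqrt_lt_sqrt_iInf_add {ι : Type*} [Nonempty ι] (F : ι → ℝ) {ε : ℝ}
    (hF : ∀ i, 0 ≤ F i) (hε : 0 < ε) : ∃ i, √(F i) < √(⨅ i, F i) + ε := by
  have h0 : 0 ≤ ⨅ i, F i := Real.iInf_nonneg hF
  have hlt : ⨅ i, F i < (√(⨅ i, F i) + ε) ^ 2 := by
    nlinarith [Real.sq_sqrt h0, Real.sqrt_nonneg (⨅ i, F i)]
  obtain ⟨i, hi⟩ := exists_lt_of_ciInf_lt hlt
  exact ⟨i, (Real.sqrt_lt' (by positivity)).2 hi⟩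

/-- 'Only if' direction of Proposition 5.4 (Kim–Pass): in a globally convex
geodesic metric space, `√var` satisfies the chord inequality along the curve of
measures `μ_t = (e_t)_*Π`, for any probability measure `Π` on `C([0,1],X)`
concentrated on geodesics whose endpoint evaluations have finite second moment. -/
theorem sqrt_var_convex_of_globally_convex {X : Type*} [MetricSpace X]
    [MeasurableSpace X] [BorelSpace X]
    [MeasurableSpace C(Icc (0 : ℝ) 1, X)] [BorelSpace C(Icc (0 : ℝ) 1, X)]
    (hgeosp : IsGeodesicSpace X) (hconv : GloballyConvex X)
    (P : Measure C(Icc (0 : ℝ) 1, X)) [IsProbabilityMeasure P]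
    (hgeo : ∀ᵐ η ∂P, IsGeodesicMap η) (x₀ x₁ : X)
    (h0 : Integrable (fun η : C(Icc (0 : ℝ) 1, X) =>
      dist x₀ (η ⟨0, by norm_num⟩) ^ 2) P)
    (h1 : Integrable (fun η : C(Icc (0 : ℝ) 1, X) =>
      dist x₁ (η ⟨1, by norm_num⟩) ^ 2) P)
    (μ : Icc (0 : ℝ) 1 → Measure X)
    (hμ : ∀ t : Icc (0 : ℝ) 1,
      μ t = Measure.map (fun η : C(Icc (0 : ℝ) 1, X) => η t) P) :
    ∀ t : Icc (0 : ℝ) 1,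
      Real.sqrt (var (μ t)) ≤
        (1 - (t : ℝ)) * Real.sqrt (var (μ ⟨0, by norm_num⟩)) +
          (t : ℝ) * Real.sqrt (var (μ ⟨1, by norm_num⟩)) := by
  intro t
  have he (s : Icc (0 : ℝ) 1) : Measurable (fun η : C(Icc (0 : ℝ) 1, X) => η s) :=
    (continuous_eval_const s).measurable
  have hnonneg (s : Icc (0 : ℝ) 1) (x : X) : 0 ≤ ∫ η, dist x (η s) ^ 2 ∂P :=
    integral_nonneg fun η => sq_nonneg _
  have : Nonempty X := ⟨x₀⟩
  simp only [hμ, var_map P (he _)]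
  refine le_of_forall_pos_le_add fun ε hε => ?_
  obtain ⟨a, ha⟩ := exists_sqrt_lt_sqrt_iInf_add _ (hnonneg ⟨0, by norm_num⟩) hε
  obtain ⟨b, hb⟩ := exists_sqrt_lt_sqrt_iInf_add _ (hnonneg ⟨1, by norm_num⟩) hε
  obtain ⟨γ, hγ, rfl, rfl⟩ := hgeosp a b
  have hbdd : BddBelow (range fun x : X => ∫ η, dist x (η t) ^ 2 ∂P) :=
    ⟨0, forall_mem_range.2 (hnonneg t)⟩
  have ht0 : (0 : ℝ) ≤ t := t.2.1
  have ht1 : (0 : ℝ) ≤ 1 - t := sub_nonneg.2 t.2.2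
  have hmink := sqrt_integral_sq_le_of_le_add (P := P) ht1 ht0
    (fun η : C(Icc (0 : ℝ) 1, X) => dist_nonneg (x := γ t) (y := η t))
    (fun _ => dist_nonneg) (fun _ => dist_nonneg)
    (memLp_dist_of_integrable_sq (he ⟨0, by norm_num⟩) h0 (γ 0))
    (memLp_dist_of_integrable_sq (he ⟨1, by norm_num⟩) h1 (γ 1))
    (hgeo.mono fun η hη => hconv.dist_le hγ hη t)
  have hinf := Real.sqrt_le_sqrt (ciInf_le hbdd (γ t))
  have ha' := mul_le_mul_of_nonneg_left ha.le ht1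
  have hb' := mul_le_mul_of_nonneg_left hb.le ht0
  linarith
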